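/- For all real parameters a > 0, b > 1 and every n ≥ 1, the n-th moment of the free beta prime distribution has the combinatorial expression ∫ xⁿ dμ_{a,b}(x) = (a/(b−1)²)ⁿ · Σ_{π ∈ NCL(n)} ((a+b−1)/a)^{dc(π)+sc(π)} · (b−1)^{sc(π)+sg(π)}. -/

import Mathlib

/-- `π` is a non-crossing linked partition of `{0, 1, …, n-1}` (identified with `[n] = {1,…,n}`):
a collection of nonempty blocks covering `Fin n`, any two distinct blocks being
non-crossing and nearly disjoint. -/
def IsNCL (n : ℕ) (π : Finset (Finset (Fin n))) : Prop :=
  (∀ B ∈ π, B.Nonempty) ∧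
  (∀ i : Fin n, ∃ B ∈ π, i ∈ B) ∧
  (∀ E ∈ π, ∀ F ∈ π, E ≠ F →
    -- non-crossing
    (¬ ∃ b₁ b₂ c₁ c₂ : Fin n, b₁ ∈ E ∧ b₂ ∈ E ∧ c₁ ∈ F ∧ c₂ ∈ F ∧
        b₁ < c₁ ∧ c₁ < b₂ ∧ b₂ < c₂) ∧
    -- nearly disjoint
    (∀ i ∈ E ∩ F,
      ((∀ j ∈ E, i ≤ j) ∧ 1 < E.card ∧ ¬ (∀ j ∈ F, i ≤ j)) ∨
      (¬ (∀ j ∈ E, i ≤ j) ∧ (∀ j ∈ F, i ≤ j) ∧ 1 < F.card)))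

/-- The set of all non-crossing linked partitions of `[n]`. -/
noncomputable def NCL (n : ℕ) : Finset (Finset (Finset (Fin n))) :=
  @Finset.filter _ (IsNCL n) (Classical.decPred _) Finset.univ

/-- `dc π`: the number of doubly covered elements. -/
def dc {n : ℕ} (π : Finset (Finset (Fin n))) : ℕ :=
  (Finset.univ.filter fun i : Fin n => (π.filter fun B => i ∈ B).card = 2).card

/-- `sc π`: the number of singly covered elements that are the minimum of a block
of size at least 2. -/
def sc {n : ℕ} (π : Finset (Finset (Fin n))) : ℕ :=
  (Finset.univ.filter fun i : Fin n =>
    (π.filter fun B => i ∈ B).card = 1 ∧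
    ∃ B ∈ π, i ∈ B ∧ (∀ j ∈ B, i ≤ j) ∧ 2 ≤ B.card).card

/-- `sg π`: the number of singleton blocks. -/
def sg {n : ℕ} (π : Finset (Finset (Fin n))) : ℕ :=
  (π.filter fun B => B.card = 1).card

open MeasureTheory Real

/-- `γ₋` for the free beta prime distribution. -/
noncomputable def gammaM (a b : ℝ) : ℝ :=
  ((Real.sqrt (a * b) - Real.sqrt (a + b - 1)) / (b - 1)) ^ 2

/-- `γ₊` for the free beta prime distribution. -/
noncomputable def gammaP (a b : ℝ) : ℝ :=
  ((Real.sqrt (a * b) + Real.sqrt (a + b - 1)) / (b - 1)) ^ 2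

/-- Density of the absolutely continuous part of the free beta prime distribution. -/
noncomputable def fbpDensity (a b : ℝ) : ℝ → ℝ :=
  Set.indicator (Set.Icc (gammaM a b) (gammaP a b))
    (fun x => (b - 1) * Real.sqrt (-((x - gammaP a b) * (x - gammaM a b)))
      / (2 * π * x * (1 + x)))

/-- The free beta prime distribution `fβ'(a, b)`. -/
noncomputable def fbp (a b : ℝ) : Measure ℝ :=
  volume.withDensity (fun x => ENNReal.ofReal (fbpDensity a b x))
    + ENNReal.ofReal (max (1 - a) 0) • Measure.dirac 0


namespace FBP
open Finset PowerSeries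

/-- `k` has a child in the parent function `f`. -/
def HC {n : ℕ} (f : Fin n → ℕ) (k : ℕ) : Prop := ∃ j : Fin n, k < j ∧ f j = k

/-- `f` is a decreasing non-crossing parent function (roots are fixed points). -/
def IsNC {n : ℕ} (f : Fin n → ℕ) : Prop :=
  (∀ j, f j ≤ j) ∧ ∀ j l : Fin n, j < l → ¬ (f j < f l ∧ f l < j)

open Classical in
noncomputable def NC (n : ℕ) : Finset (Fin n → ℕ) :=
  (Fintype.piFinset (fun j : Fin n => range (j + 1))).filter IsNC

lemma mem_NC {n : ℕ} {f : Fin n → ℕ} : f ∈ NC n ↔ IsNC f := by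
  simp only [NC, mem_filter, Fintype.mem_piFinset, mem_range, and_iff_right_iff_imp]
  intro h j
  exact Nat.lt_succ_of_le (h.1 j)

open Classical in
/-- accessible vertices. -/
noncomputable def acc {n : ℕ} (f : Fin n → ℕ) : Finset ℕ :=
  (range n).filter (fun k => ∀ j : Fin n, ¬ (f j < k ∧ k < j))

open Classical in
noncomputable def hf (P : ℝ) {n : ℕ} (f : Fin n → ℕ) (k : ℕ) : ℝ := if HC f k then P else 1

lemma hf_congr (P : ℝ) {n m : ℕ} {f : Fin n → ℕ} {g : Fin m → ℕ} {k : ℕ} (h : HC f k ↔ HC g k) :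
    hf P f k = hf P g k := by
  unfold hf
  by_cases h1 : HC g k <;> simp [h1, h]

noncomputable def wt (P Q : ℝ) {n : ℕ} (f : Fin n → ℕ) : ℝ :=
  (∏ k ∈ range n, hf P f k) * ∏ j : Fin n, if f j = j then Q else 1

open Classical in
noncomputable def pf (P : ℝ) {n : ℕ} (f : Fin n → ℕ) (k : ℕ) : ℝ := if HC f k then 1 else P

lemma pf_congr (P : ℝ) {n m : ℕ} {f : Fin n → ℕ} {g : Fin m → ℕ} {k : ℕ} (h : HC f k ↔ HC g k) :
    pf P f k = pf P g k := by
  unfold pf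
  by_cases h1 : HC g k <;> simp [h1, h]

noncomputable def Phi (P : ℝ) (e : ℝ⟦X⟧) {n : ℕ} (f : Fin n → ℕ) : ℝ⟦X⟧ :=
  ∏ k ∈ acc f, (1 + C (pf P f k) * e)

abbrev sn {n : ℕ} (f : Fin n → ℕ) (v : ℕ) : Fin (n + 1) → ℕ := Fin.snoc (α := fun _ => ℕ) f v

lemma hc_snoc {n : ℕ} (f : Fin n → ℕ) (v k : ℕ) :
    HC (sn f v) k ↔ HC f k ∨ (k < n ∧ v = k) := by
  constructor
  · rintro ⟨j, h1, h2⟩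
    induction j using Fin.lastCases with
    | last => right; simpa using And.intro h1 h2
    | cast j => left; exact ⟨j, by simpa using h1, by simpa using h2⟩
  · rintro (⟨j, h1, h2⟩ | ⟨h1, h2⟩)
    · exact ⟨j.castSucc, by simpa using h1, by simpa using h2⟩
    · exact ⟨Fin.last n, by simpa using h1, by simpa using h2⟩

lemma hc_lt {n : ℕ} {f : Fin n → ℕ} {k : ℕ} (h : HC f k) : k < n := by
  obtain ⟨j, h1, -⟩ := h
  omega

lemma isNC_snoc {n : ℕ} (f : Fin n → ℕ) (v : ℕ) :
    IsNC (sn f v) ↔ IsNC f ∧ (v = n ∨ v ∈ acc f) := by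
  simp only [IsNC, acc, mem_filter, mem_range, Fin.forall_fin_succ', sn, Fin.snoc_castSucc,
    Fin.snoc_last, Fin.val_castSucc, Fin.val_last, Fin.castSucc_lt_castSucc_iff]
  constructor
  · rintro ⟨⟨h1, h2⟩, h3, h4⟩
    refine ⟨⟨h1, fun j l => (h3 j).1 l⟩, ?_⟩
    rcases h2.eq_or_lt with h | h
    · exact Or.inl h
    · exact Or.inr ⟨h, fun j => (h3 j).2 (Fin.castSucc_lt_last j)⟩
  · rintro ⟨⟨h1, h2⟩, h3⟩
    refine ⟨⟨h1, ?_⟩, ?_, ?_⟩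
    · rcases h3 with h | h <;> omega
    · intro j
      refine ⟨h2 j, fun _ => ?_⟩
      rcases h3 with h | h
      · have := j.2
        omega
      · exact h.2 j
    · refine ⟨fun l hl => ?_, fun hl => ?_⟩
      · exact absurd hl (by simpa using (Fin.castSucc_lt_last l).le)
      · simp at hl

lemma acc_snoc {n : ℕ} (f : Fin n → ℕ) (v : ℕ) :
    acc (sn f v) = insert n ((acc f).filter (fun k => k ≤ v)) := by
  ext k
  simp only [acc, mem_filter, mem_range, Fin.forall_fin_succ', sn, Fin.snoc_castSucc,
    Fin.snoc_last, Fin.val_castSucc, Fin.val_last, mem_insert]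
  constructor
  · rintro ⟨h1, h2, h3⟩
    by_cases hk : k = n
    · exact Or.inl hk
    · exact Or.inr ⟨⟨by omega, h2⟩, by omega⟩
  · rintro (h | ⟨⟨h1, h2⟩, h3⟩)
    · refine ⟨by omega, fun j => ?_, by omega⟩
      have := j.2
      omega
    · exact ⟨by omega, h2, by omega⟩

lemma not_mem_acc {n : ℕ} (f : Fin n → ℕ) : n ∉ acc f := by simp [acc]

lemma sum_NC_succ {n : ℕ} {R : Type*} [AddCommMonoid R] (g : (Fin (n + 1) → ℕ) → R) :
    ∑ f ∈ NC (n + 1), g f = ∑ f ∈ NC n, ∑ v ∈ insert n (acc f), g (sn f v) := by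
  rw [Finset.sum_sigma']
  refine Finset.sum_bij' (fun f _ => ⟨fun j => f j.castSucc, f (Fin.last n)⟩)
    (fun x _ => sn x.1 x.2) ?_ ?_ ?_ ?_ ?_
  · intro f hf
    have h2 : sn (fun j => f j.castSucc) (f (Fin.last n)) = f := Fin.snoc_init_self f
    rw [mem_NC, ← h2, isNC_snoc] at hf
    simpa [mem_NC] using hf
  · rintro ⟨f, v⟩ h
    simp only [mem_sigma, mem_NC, mem_insert] at h
    rw [mem_NC, isNC_snoc]
    exact h
  · intro f hf
    exact Fin.snoc_init_self f
  · rintro ⟨f, v⟩ h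
    simp [sn]
  · intro f hf
    have h2 : sn (fun j => f j.castSucc) (f (Fin.last n)) = f := Fin.snoc_init_self f
    simp only [h2]

lemma wt_snoc_root (P Q : ℝ) {n : ℕ} (f : Fin n → ℕ) :
    wt P Q (sn f n) = Q * wt P Q f := by
  have h0 : ∀ k, HC (sn f n) k ↔ HC f k := by
    intro k
    rw [hc_snoc]
    constructor
    · rintro (h | h)
      · exact h
      · omega
    · exact Or.inl
  have h1 : ¬ HC f n := fun h => (hc_lt h).false
  have h2 : hf P f n = 1 := by simp [hf, h1]
  simp only [wt, fun k => hf_congr P (h0 k)]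
  rw [prod_range_succ, Fin.prod_univ_castSucc, h2]
  simp [sn]
  ring

lemma wt_snoc_acc (P Q : ℝ) {n : ℕ} (f : Fin n → ℕ) (v : ℕ) (hv : v < n) :
    wt P Q (sn f v) = pf P f v * wt P Q f := by
  have h1 : ¬ HC (sn f v) n := by
    rw [hc_snoc]
    rintro (h | h)
    · exact (hc_lt h).false
    · omega
  simp only [wt]
  rw [prod_range_succ, Fin.prod_univ_castSucc]
  have h2 : (∏ k ∈ range n, hf P (sn f v) k)
      = pf P f v * ∏ k ∈ range n, hf P f k := by
    rw [← Finset.mul_prod_erase _ _ (mem_range.2 hv), ← Finset.mul_prod_erase _ _ (mem_range.2 hv),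
      ← mul_assoc]
    congr 1
    · have : HC (sn f v) v := by rw [hc_snoc]; exact Or.inr ⟨hv, rfl⟩
      simp only [this, pf, hf]
      split_ifs <;> simp
    · refine Finset.prod_congr rfl fun k hk => ?_
      have : HC (sn f v) k ↔ HC f k := by
        rw [hc_snoc]
        have := (mem_erase.1 hk).1
        constructor
        · rintro (h | h)
          · exact h
          · omega
        · exact Or.inl
      exact hf_congr P this
  have h3 : hf P (sn f v) n = 1 := by simp [hf, h1]
  rw [h2, h3]
  simp [sn, hv.ne]
  ring

lemma Phi_snoc_root (P : ℝ) (e : ℝ⟦X⟧) {n : ℕ} (f : Fin n → ℕ) :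
    Phi P e (sn f n) = (1 + C P * e) * Phi P e f := by
  have h1 : ¬ HC (sn f n) n := by
    rw [hc_snoc]
    rintro (h | h)
    · exact (hc_lt h).false
    · omega
  unfold Phi
  rw [acc_snoc, prod_insert (fun h => not_mem_acc f (mem_filter.1 h).1)]
  congr 1
  · simp [pf, h1]
  · have : (acc f).filter (fun k => k ≤ n) = acc f := by
      refine Finset.filter_true_of_mem fun k hk => ?_
      simp only [acc, mem_filter, mem_range] at hk
      omega
    rw [this]
    refine Finset.prod_congr rfl fun k hk => ?_
    have : HC (sn f n) k ↔ HC f k := by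
      rw [hc_snoc]
      constructor
      · rintro (h | h)
        · exact h
        · omega
      · exact Or.inl
    rw [pf_congr P this]

lemma Phi_snoc_acc (P : ℝ) (e : ℝ⟦X⟧) {n : ℕ} (f : Fin n → ℕ) (v : ℕ) (hv : v ∈ acc f) :
    Phi P e (sn f v) = (1 + C P * e) * (1 + e) *
      ∏ k ∈ (acc f).filter (fun k => k < v), (1 + C (pf P f k) * e) := by
  have hvn : v < n := by
    simp only [acc, mem_filter, mem_range] at hv
    exact hv.1
  have h1 : ¬ HC (sn f v) n := by
    rw [hc_snoc]
    rintro (h | h)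
    · exact (hc_lt h).false
    · omega
  have h3 : HC (sn f v) v := by rw [hc_snoc]; exact Or.inr ⟨hvn, rfl⟩
  have h2 : (acc f).filter (fun k => k ≤ v) = insert v ((acc f).filter (fun k => k < v)) := by
    ext k
    simp only [mem_filter, mem_insert]
    constructor
    · rintro ⟨h, h'⟩
      rcases h'.eq_or_lt with h'' | h''
      · exact Or.inl h''
      · exact Or.inr ⟨h, h''⟩
    · rintro (h | h)
      · subst h; exact ⟨hv, le_rfl⟩
      · exact ⟨h.1, h.2.le⟩
  unfold Phi
  rw [acc_snoc, prod_insert (fun h => not_mem_acc f (mem_filter.1 h).1), h2,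
    prod_insert (by simp), mul_assoc]
  congr 1
  · simp [pf, h1]
  congr 1
  · simp [pf, h3]
  · refine Finset.prod_congr rfl fun k hk => ?_
    have hk' := (mem_filter.1 hk).2
    have : HC (sn f v) k ↔ HC f k := by
      rw [hc_snoc]
      constructor
      · rintro (h | h)
        · exact h
        · omega
      · exact Or.inl
    rw [pf_congr P this]

lemma step (P Q : ℝ) (M e : ℝ⟦X⟧) (hM : M = 1 + X * C Q * M * (1 + C P * e))
    (he : e = X * M * (1 + C P * e) * (1 + e)) {n : ℕ} (f : Fin n → ℕ) :
    C (wt P Q f) * (M * Phi P e f) = C (wt P Q f) +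
      X * ∑ v ∈ insert n (acc f), C (wt P Q (sn f v)) * (M * Phi P e (sn f v)) := by
  rw [sum_insert (not_mem_acc f), wt_snoc_root, Phi_snoc_root]
  have h1 : X * ∑ v ∈ acc f, C (wt P Q (sn f v)) * (M * Phi P e (sn f v))
      = C (wt P Q f) * (Phi P e f - 1) := by
    have h2 : Phi P e f - 1 = ∑ v ∈ acc f, (C (pf P f v) * e) *
        ∏ k ∈ (acc f).filter (fun k => k < v), (1 + C (pf P f k) * e) := by
      unfold Phi
      rw [Finset.prod_one_add_ordered]
      ring
    rw [h2, mul_sum, mul_sum]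
    refine Finset.sum_congr rfl fun v hv => ?_
    have hvn : v < n := by
      simp only [acc, mem_filter, mem_range] at hv
      exact hv.1
    rw [wt_snoc_acc _ _ _ _ hvn, Phi_snoc_acc _ _ _ _ hv, map_mul]
    conv_rhs => rw [mul_assoc (C (pf P f v)) e]
    conv_rhs => enter [2, 2, 1]; rw [he]
    ring
  rw [mul_add, h1, map_mul]
  conv_lhs => rw [hM]
  ring

lemma coeff_M (P Q : ℝ) (M e : ℝ⟦X⟧) (hM : M = 1 + X * C Q * M * (1 + C P * e))
    (he : e = X * M * (1 + C P * e) * (1 + e)) (n : ℕ) :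
    coeff n M = ∑ f ∈ NC n, wt P Q f := by
  set W : ℕ → ℝ⟦X⟧ := fun n => ∑ f ∈ NC n, C (wt P Q f) * (M * Phi P e f) with hW
  have hs : ∀ n, W n = C (∑ f ∈ NC n, wt P Q f) + X * W (n + 1) := by
    intro n
    simp only [hW]
    rw [sum_NC_succ, map_sum, mul_sum, ← sum_add_distrib]
    exact Finset.sum_congr rfl fun f _ => step P Q M e hM he f
  have h0 : W 0 = M := by
    have h1 : NC 0 = {fun j => j.elim0} := by
      ext f
      simp only [mem_NC, mem_singleton]
      constructor
      · intro _; exact Subsingleton.elim _ _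
      · intro _; exact ⟨fun j => j.elim0, fun j => j.elim0⟩
    simp [hW, h1, wt, Phi, acc]
  have hc : ∀ m n, coeff m (W n) = ∑ f ∈ NC (n + m), wt P Q f := by
    intro m
    induction m with
    | zero => intro n; rw [hs]; simp
    | succ m ih =>
      intro n
      rw [hs, map_add, coeff_succ_X_mul, ih, coeff_C]
      have h3 : n + 1 + m = n + (m + 1) := by omega
      rw [h3]
      simp
  rw [← h0, hc, zero_add]

end FBP

namespace FBP
open Finset

open Classical in
/-- the block rooted at `i`. -/
noncomputable def blk {n : ℕ} (f : Fin n → ℕ) (i : Fin n) : Finset (Fin n) :=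
  univ.filter (fun j => j = i ∨ f j = i)

open Classical in
noncomputable def toP {n : ℕ} (f : Fin n → ℕ) : Finset (Finset (Fin n)) :=
  (univ.filter (fun i : Fin n => f i = i ∨ HC f i)).image (blk f)

lemma mem_blk {n : ℕ} {f : Fin n → ℕ} {i j : Fin n} : j ∈ blk f i ↔ j = i ∨ f j = i := by
  simp [blk]

lemma self_mem_blk {n : ℕ} {f : Fin n → ℕ} {i : Fin n} : i ∈ blk f i := by
  simp [blk]

lemma blk_min {n : ℕ} {f : Fin n → ℕ} (hf : IsNC f) {i j : Fin n} (h : j ∈ blk f i) : i ≤ j := by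
  rcases mem_blk.1 h with h | h
  · exact h.ge
  · have := hf.1 j
    rw [Fin.le_def]; omega

lemma blk_inj {n : ℕ} {f : Fin n → ℕ} (hf : IsNC f) {i j : Fin n} (h : blk f i = blk f j) :
    i = j := by
  apply le_antisymm
  · exact blk_min hf (h ▸ self_mem_blk)
  · exact blk_min hf (h ▸ self_mem_blk)

lemma mem_toP {n : ℕ} {f : Fin n → ℕ} {B : Finset (Fin n)} :
    B ∈ toP f ↔ ∃ i : Fin n, (f i = i ∨ HC f i) ∧ blk f i = B := by
  simp [toP]

lemma blk_mem_toP {n : ℕ} {f : Fin n → ℕ} (hf : IsNC f) {i : Fin n} :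
    blk f i ∈ toP f ↔ (f i = i ∨ HC f i) := by
  rw [mem_toP]
  constructor
  · rintro ⟨k, h, h2⟩
    rw [← blk_inj hf h2]; exact h
  · intro h; exact ⟨i, h, rfl⟩

lemma card_blk {n : ℕ} {f : Fin n → ℕ} (hf : IsNC f) {i : Fin n} :
    1 < (blk f i).card ↔ HC f i := by
  rw [Finset.one_lt_card_iff]
  constructor
  · rintro ⟨p, q, hp, hq, hpq⟩
    have hp' := blk_min hf hp
    have hq' := blk_min hf hq
    rw [mem_blk] at hp hq
    by_cases h : p = i
    · subst h
      have h2 : f q = p := hq.resolve_left (Ne.symm hpq)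
      exact ⟨q, by simpa using lt_of_le_of_ne hq' hpq, h2⟩
    · exact ⟨p, by simpa using lt_of_le_of_ne hp' (Ne.symm h), hp.resolve_left h⟩
  · rintro ⟨j, h1, h2⟩
    refine ⟨i, j, self_mem_blk, mem_blk.2 (Or.inr h2), ?_⟩
    rintro rfl
    exact h1.false

lemma min_blk {n : ℕ} {f : Fin n → ℕ} (hf : IsNC f) {i k : Fin n} (h : i ∈ blk f k) :
    (∀ j ∈ blk f k, i ≤ j) ↔ i = k := by
  constructor
  · intro h2
    exact le_antisymm (h2 k self_mem_blk) (blk_min hf h)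
  · rintro rfl j hj
    exact blk_min hf hj

lemma toP_mem {n : ℕ} {f : Fin n → ℕ} (hf : IsNC f) : IsNCL n (toP f) := by
  refine ⟨?_, ?_, ?_⟩
  · intro B hB
    obtain ⟨i, -, rfl⟩ := mem_toP.1 hB
    exact ⟨i, self_mem_blk⟩
  · intro i
    rcases (hf.1 i).eq_or_lt with h | h
    · exact ⟨blk f i, (blk_mem_toP hf).2 (Or.inl h), self_mem_blk⟩
    · refine ⟨blk f ⟨f i, h.trans i.2⟩, (blk_mem_toP hf).2 (Or.inr ⟨i, h, rfl⟩), ?_⟩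
      exact mem_blk.2 (Or.inr rfl)
  · intro E hE F hF hEF
    obtain ⟨i, hi, rfl⟩ := mem_toP.1 hE
    obtain ⟨k, hk, rfl⟩ := mem_toP.1 hF
    have hik : i ≠ k := fun h => hEF (by rw [h])
    constructor
    · rintro ⟨b1, b2, c1, c2, hb1, hb2, hc1, hc2, h1, h2, h3⟩
      have ib1 := blk_min hf hb1
      have kc1 := blk_min hf hc1
      have fb2 : f b2 = i := (mem_blk.1 hb2).resolve_left (by rintro rfl; omega)
      have fc2 : f c2 = k := (mem_blk.1 hc2).resolve_left (by rintro rfl; omega)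
      rcases lt_or_gt_of_ne hik with h | h
      · exact hf.2 b2 c2 h3 ⟨by rw [fb2, fc2]; exact h, by rw [fc2]; exact lt_of_le_of_lt kc1 h2⟩
      · have fc1 : f c1 = k := (mem_blk.1 hc1).resolve_left (by rintro rfl; omega)
        exact hf.2 c1 b2 h2 ⟨by rw [fb2, fc1]; exact h, by rw [fb2]; exact lt_of_le_of_lt ib1 h1⟩
    · intro j hj
      rw [mem_inter] at hj
      rw [min_blk hf hj.1, min_blk hf hj.2, card_blk hf, card_blk hf]
      have h1 := mem_blk.1 hj.1
      have h2 := mem_blk.1 hj.2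
      rcases h1 with h1 | h1
      · subst h1
        have h3 : f j = k := h2.resolve_left hik
        left
        refine ⟨rfl, hi.resolve_left ?_, hik⟩
        rw [h3]
        exact fun h => hik (Fin.ext h.symm)
      · rcases h2 with h2 | h2
        · subst h2
          right
          refine ⟨Ne.symm hik, rfl, hk.resolve_left ?_⟩
          rw [h1]
          exact fun h => hik (Fin.ext h)
        · exact absurd (Fin.ext (h1.symm.trans h2)) hik

lemma toP_inj_aux {n : ℕ} {f g : Fin n → ℕ} (hf : IsNC f) (hg : IsNC g) (h : toP f = toP g)
    (j : Fin n) (hj : f j < j) : g j = f j := by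
  set k : Fin n := ⟨f j, hj.trans j.2⟩ with hk
  have h1 : blk f k ∈ toP g := by
    rw [← h, blk_mem_toP hf]
    exact Or.inr ⟨j, hj, rfl⟩
  obtain ⟨i, -, h2⟩ := mem_toP.1 h1
  have hik : i = k := by
    apply le_antisymm
    · exact blk_min hg (h2 ▸ self_mem_blk)
    · exact blk_min hf (h2 ▸ self_mem_blk)
  have h3 : j ∈ blk g i := by
    rw [h2]
    exact mem_blk.2 (Or.inr rfl)
  rcases mem_blk.1 h3 with h4 | h4
  · rw [h4, hik] at hj
    subst hik
    rw [← h4] at hk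
    have := congrArg Fin.val hk
    simp only at this
    omega
  · rw [h4, hik]

lemma toP_inj {n : ℕ} {f g : Fin n → ℕ} (hf : IsNC f) (hg : IsNC g) (h : toP f = toP g) :
    f = g := by
  funext j
  rcases (hf.1 j).eq_or_lt with h1 | h1
  · rcases (hg.1 j).eq_or_lt with h2 | h2
    · rw [h1, h2]
    · exact toP_inj_aux hg hf h.symm j h2
  · exact (toP_inj_aux hf hg h j h1).symm

lemma toP_surj {n : ℕ} {p : Finset (Finset (Fin n))} (hp : IsNCL n p) :
    ∃ f : Fin n → ℕ, IsNC f ∧ toP f = p := by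
  classical
  obtain ⟨hne, hcov, hpair⟩ := hp
  -- uniqueness of block with given minimum
  have umin : ∀ E ∈ p, ∀ F ∈ p, ∀ i, i ∈ E → i ∈ F → (∀ j ∈ E, i ≤ j) → (∀ j ∈ F, i ≤ j) →
      E = F := by
    intro E hE F hF i h1 h2 h3 h4
    by_contra hne
    rcases (hpair E hE F hF hne).2 i (mem_inter.2 ⟨h1, h2⟩) with h | h
    · exact h.2.2 h4
    · exact h.1 h3
  have unon : ∀ E ∈ p, ∀ F ∈ p, ∀ i, i ∈ E → i ∈ F → ¬ (∀ j ∈ E, i ≤ j) → ¬ (∀ j ∈ F, i ≤ j) →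
      E = F := by
    intro E hE F hF i h1 h2 h3 h4
    by_contra hne
    rcases (hpair E hE F hF hne).2 i (mem_inter.2 ⟨h1, h2⟩) with h | h
    · exact h3 h.1
    · exact h4 h.2.1
  have hex : ∀ j : Fin n, ∃ k : Fin n,
      (∃ B ∈ p, j ∈ B ∧ k ∈ B ∧ (∀ l ∈ B, k ≤ l) ∧ k < j) ∨
      ((∀ B ∈ p, j ∈ B → ∀ l ∈ B, j ≤ l) ∧ k = j) := by
    intro j
    by_cases h : ∀ B ∈ p, j ∈ B → ∀ l ∈ B, j ≤ l
    · exact ⟨j, Or.inr ⟨h, rfl⟩⟩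
    · push Not at h
      obtain ⟨B, hB, hj, l, hl, hlj⟩ := h
      refine ⟨B.min' ⟨j, hj⟩, Or.inl ⟨B, hB, hj, B.min'_mem _, fun l hl => B.min'_le l hl, ?_⟩⟩
      exact lt_of_le_of_lt (B.min'_le l hl) hlj
  choose g hg using hex
  have gle : ∀ j, g j ≤ j := by
    intro j
    rcases hg j with ⟨B, -, -, -, -, h⟩ | ⟨-, h⟩
    · exact h.le
    · exact h.le
  -- blocks
  have gblock : ∀ B ∈ p, ∀ i ∈ B, (∀ l ∈ B, i ≤ l) → ∀ j, j ≠ i → (j ∈ B ↔ g j = i) := by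
    intro B hB i hi hmin j hji
    constructor
    · intro hj
      have hnm : ¬ ∀ l ∈ B, j ≤ l := fun h => hji (le_antisymm (h i hi) (hmin j hj))
      rcases hg j with ⟨B', hB', hj', hk, hkm, hlt⟩ | ⟨h, -⟩
      · have : B = B' := unon B hB B' hB' j hj hj' hnm
          (fun h => absurd (h _ hk) (not_le.2 hlt))
        subst this
        exact le_antisymm (hkm i hi) (hmin _ hk)
      · exact absurd (h B hB hj) hnm
    · intro hgj
      rcases hg j with ⟨B', hB', hj', hk, hkm, hlt⟩ | ⟨-, h⟩
      · rw [hgj] at hk hkm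
        have : B = B' := umin B hB B' hB' i hi hk hmin hkm
        subst this
        exact hj'
      · exact absurd (h.symm.trans hgj) hji
  set f : Fin n → ℕ := fun j => (g j : ℕ) with hfdef
  have feq : ∀ j i : Fin n, f j = i ↔ g j = i := by
    intro j i
    simp only [hfdef, Fin.ext_iff]
  have bblk : ∀ B ∈ p, ∀ i ∈ B, (∀ l ∈ B, i ≤ l) → blk f i = B := by
    intro B hB i hi hmin
    ext j
    rw [mem_blk, feq]
    by_cases h : j = i
    · subst h; simp [hi]
    · rw [gblock B hB i hi hmin j h]
      simp [h]
  refine ⟨f, ⟨fun j => gle j, ?_⟩, ?_⟩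
  · rintro j l hjl ⟨h1, h2⟩
    have h1' : g j < g l := h1
    have h2' : g l < j := h2
    rcases hg j with ⟨B, hB, hj, hk, hkm, hlt⟩ | ⟨-, h⟩
    · rcases hg l with ⟨B', hB', hl, hk', hkm', hlt'⟩ | ⟨-, h⟩
      · have hBB : B ≠ B' := by
          rintro rfl
          exact absurd (hkm' _ hk) (not_le.2 h1')
        exact (hpair B hB B' hB' hBB).1 ⟨g j, j, g l, l, hk, hj, hk', hl, h1', h2', hjl⟩
      · omega
    · omega
  · ext B
    rw [mem_toP]
    constructor
    · rintro ⟨i, h, rfl⟩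
      have key : ∃ B ∈ p, i ∈ B ∧ ∀ l ∈ B, i ≤ l := by
        rcases h with h | ⟨j, h1, h2⟩
        · rw [feq] at h
          obtain ⟨B, hB, hi⟩ := hcov i
          rcases hg i with ⟨B', -, -, -, -, hlt⟩ | ⟨h', -⟩
          · exact absurd h hlt.ne
          · exact ⟨B, hB, hi, h' B hB hi⟩
        · rw [feq] at h2
          rcases hg j with ⟨B', hB', hj, hk, hkm, hlt⟩ | ⟨-, h'⟩
          · rw [h2] at hk hkm
            exact ⟨B', hB', hk, hkm⟩
          · rw [h2] at h'
            rw [h'] at h1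
            exact absurd h1 (lt_irrefl _)
      obtain ⟨B, hB, hi, hm⟩ := key
      rw [bblk B hB i hi hm]
      exact hB
    · intro hB
      set i := B.min' (hne B hB) with hi
      have him : i ∈ B := B.min'_mem _
      have hmin : ∀ l ∈ B, i ≤ l := fun l hl => B.min'_le l hl
      refine ⟨i, ?_, bblk B hB i him hmin⟩
      rcases hg i with ⟨B', hB', hj, hk, hkm, hlt⟩ | ⟨-, h⟩
      · right
        have hBB : B ≠ B' := by
          rintro rfl
          exact absurd (hmin _ hk) (not_le.2 hlt)
        have hcard : 1 < B.card := by
          rcases (hpair B hB B' hB' hBB).2 i (mem_inter.2 ⟨him, hj⟩) with h | h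
          · exact h.2.1
          · exact absurd (h.2.1 _ hk) (not_le.2 hlt)
        obtain ⟨q, hq, hqi⟩ := Finset.exists_mem_ne hcard i
        refine ⟨q, ?_, ?_⟩
        · have h5 : i < q := lt_of_le_of_ne (hmin q hq) (Ne.symm hqi)
          exact h5
        · rw [feq]
          exact (gblock B hB i him hmin q hqi).1 hq
      · left
        rw [feq]
        exact h

section weights
open Classical

lemma blocks_of {n : ℕ} {f : Fin n → ℕ} (hf : IsNC f) (i : Fin n) :
    ((toP f).filter fun B => i ∈ B).card
      = (if f i = i ∨ HC f i then 1 else 0) + (if f i = i then 0 else 1) := by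
  have hlt : f i < n := lt_of_le_of_lt (hf.1 i) i.2
  set k : Fin n := ⟨f i, hlt⟩ with hk
  have hkv : f i = (k : ℕ) := rfl
  have hmem : ∀ B, B ∈ (toP f).filter (fun B => i ∈ B) ↔
      (B = blk f i ∧ (f i = i ∨ HC f i)) ∨ (B = blk f k ∧ ¬ f i = i) := by
    intro B
    rw [mem_filter, mem_toP]
    constructor
    · rintro ⟨⟨l, h1, rfl⟩, h2⟩
      rcases mem_blk.1 h2 with h3 | h3
      · subst h3; exact Or.inl ⟨rfl, h1⟩
      · have hl : l = k := Fin.ext (h3.symm.trans hkv)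
        by_cases h4 : f i = i
        · have : l = i := Fin.ext (h3.symm.trans h4)
          subst this
          exact Or.inl ⟨rfl, h1⟩
        · exact Or.inr ⟨by rw [hl], h4⟩
    · rintro (⟨rfl, h⟩ | ⟨rfl, h⟩)
      · exact ⟨⟨i, h, rfl⟩, self_mem_blk⟩
      · refine ⟨⟨k, Or.inr ⟨i, ?_, rfl⟩, rfl⟩, mem_blk.2 (Or.inr rfl)⟩
        exact lt_of_le_of_ne (hf.1 i) h
  by_cases h1 : f i = i
  · have : (toP f).filter (fun B => i ∈ B) = {blk f i} := by
      ext B; rw [hmem]; simp [h1]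
    rw [this]; simp [h1]
  · by_cases h2 : HC f i
    · have : (toP f).filter (fun B => i ∈ B) = {blk f i, blk f k} := by
        ext B; rw [hmem]; simp [h1, h2]
      rw [this, card_pair]
      · simp [h1, h2]
      · intro h
        have := blk_inj hf h
        rw [← this] at hkv
        exact h1 hkv
    · have : (toP f).filter (fun B => i ∈ B) = {blk f k} := by
        ext B; rw [hmem]; simp [h1, h2]
      rw [this]; simp [h1, h2]

lemma dc_toP {n : ℕ} {f : Fin n → ℕ} (hf : IsNC f) :
    dc (toP f) = (univ.filter fun i : Fin n => HC f i ∧ ¬ f i = i).card := by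
  unfold dc
  congr 1
  ext i
  simp only [mem_filter, mem_univ, true_and]
  have h := blocks_of hf i
  rw [show ((toP f).filter fun B => i ∈ B).card = _ from by convert h]
  by_cases h1 : f i = i <;> by_cases h2 : HC f i <;> simp [h1, h2]

lemma sc_toP {n : ℕ} {f : Fin n → ℕ} (hf : IsNC f) :
    sc (toP f) = (univ.filter fun i : Fin n => HC f i ∧ f i = i).card := by
  unfold sc
  congr 1
  ext i
  simp only [mem_filter, mem_univ, true_and]
  have h := blocks_of hf i
  rw [show ((toP f).filter fun B => i ∈ B).card = _ from by convert h]
  have h3 : (∃ B ∈ toP f, i ∈ B ∧ (∀ j ∈ B, i ≤ j) ∧ 2 ≤ B.card) ↔ HC f i := by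
    constructor
    · rintro ⟨B, hB, hi, hm, hc⟩
      obtain ⟨k, -, rfl⟩ := mem_toP.1 hB
      rw [min_blk hf hi] at hm
      subst hm
      exact (card_blk hf).1 hc
    · intro h
      exact ⟨blk f i, (blk_mem_toP hf).2 (Or.inr h), self_mem_blk,
        fun j hj => blk_min hf hj, (card_blk hf).2 h⟩
  rw [h3]
  by_cases h1 : f i = i <;> by_cases h2 : HC f i <;> simp [h1, h2]

lemma sg_toP {n : ℕ} {f : Fin n → ℕ} (hf : IsNC f) :
    sg (toP f) = (univ.filter fun i : Fin n => ¬ HC f i ∧ f i = i).card := by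
  unfold sg
  symm
  refine Finset.card_bij (fun i _ => blk f i) ?_ ?_ ?_
  · intro i hi
    simp only [mem_filter, mem_univ, true_and] at hi
    rw [mem_filter, blk_mem_toP hf]
    refine ⟨Or.inl hi.2, ?_⟩
    have h1 := mt (card_blk hf).1 hi.1
    have h2 : 0 < (blk f i).card := card_pos.2 ⟨i, self_mem_blk⟩
    omega
  · intro i _ j _ h
    exact blk_inj hf h
  · intro B hB
    rw [mem_filter] at hB
    obtain ⟨hB, hc⟩ := hB
    obtain ⟨i, hi, rfl⟩ := mem_toP.1 hB
    refine ⟨i, ?_, rfl⟩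
    have h1 : ¬ HC f i := by
      rw [← card_blk hf]; omega
    simp only [mem_filter, mem_univ, true_and]
    exact ⟨h1, hi.resolve_right h1⟩

lemma wt_toP (P Q : ℝ) {n : ℕ} {f : Fin n → ℕ} (hf : IsNC f) :
    P ^ (dc (toP f) + sc (toP f)) * Q ^ (sc (toP f) + sg (toP f)) = wt P Q f := by
  have h1 : dc (toP f) + sc (toP f) = (univ.filter fun i : Fin n => HC f i).card := by
    rw [dc_toP hf, sc_toP hf, ← filter_filter, ← filter_filter, add_comm,
      card_filter_add_card_filter_not]
  have h2 : sc (toP f) + sg (toP f) = (univ.filter fun i : Fin n => f i = i).card := by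
    rw [sc_toP hf, sg_toP hf]
    simp only [fun i : Fin n => and_comm (a := HC f i) (b := f i = i),
      fun i : Fin n => and_comm (a := ¬ HC f i) (b := f i = i)]
    rw [← filter_filter, ← filter_filter, card_filter_add_card_filter_not]
  rw [h1, h2, wt, ← Fin.prod_univ_eq_prod_range]
  congr 1
  · simp only [FBP.hf]
    rw [prod_ite]
    simp
  · rw [prod_ite]
    simp

end weights

lemma sum_NCL (P Q : ℝ) (n : ℕ) :
    ∑ p ∈ NCL n, P ^ (dc p + sc p) * Q ^ (sc p + sg p) = ∑ f ∈ NC n, wt P Q f := by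
  symm
  refine Finset.sum_bij (fun f _ => toP f) ?_ ?_ ?_ ?_
  · intro f hf
    simp only [NCL, mem_filter, mem_univ, true_and]
    exact toP_mem (mem_NC.1 hf)
  · intro f hf g hg h
    exact toP_inj (mem_NC.1 hf) (mem_NC.1 hg) h
  · intro p hp
    simp only [NCL, mem_filter, mem_univ, true_and] at hp
    obtain ⟨f, hf, h⟩ := toP_surj hp
    exact ⟨f, mem_NC.2 hf, h⟩
  · intro f hf
    exact (wt_toP P Q (mem_NC.1 hf)).symm

end FBP

namespace FBP
open PowerSeries

lemma ode_aux (S : ℕ → ℝ) (c g : ℝ) (h0 : S 0 = 1) (h1 : S 1 = c)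
    (hr : ∀ k : ℕ, ((k : ℝ) + 4) * S (k + 2) = (2 * k + 5) * c * S (k + 1) - (k + 1) * g * S k) :
    2 * mk S - C (3 * c) * (X * mk S) + C g * (X * (X * mk S)) + X * d⁄dX ℝ (mk S)
      - C (2 * c) * (X * (X * d⁄dX ℝ (mk S))) + C g * (X * (X * (X * d⁄dX ℝ (mk S)))) = 2 := by
  have two : (2 : ℝ⟦X⟧) = C (2 : ℝ) := (map_ofNat C 2).symm
  rw [two]
  ext n
  rcases n with _ | _ | n
  · simp [h0]
  · simp only [map_add, map_sub, coeff_C_mul, coeff_succ_X_mul, coeff_derivative, coeff_mk, coeff_C]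
    simp [h0, h1, coeff_zero_X_mul]
    ring
  · rcases n with _ | n
    · have := hr 0
      simp only [map_add, map_sub, coeff_C_mul, coeff_succ_X_mul, coeff_derivative, coeff_mk,
        coeff_C, coeff_zero_X_mul]
      simp at this ⊢
      linear_combination this
    · have := hr (n + 1)
      simp only [map_add, map_sub, coeff_C_mul, coeff_succ_X_mul, coeff_derivative, coeff_mk,
        coeff_C]
      push_cast at this ⊢
      linear_combination this

lemma quad_aux (S : ℕ → ℝ) (c r : ℝ) (hρ : r ≠ 0) (h0 : S 0 = 1) (h1 : S 1 = c)
    (hr : ∀ k : ℕ, ((k : ℝ) + 4) * S (k + 2) =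
      (2 * k + 5) * c * S (k + 1) - (k + 1) * (c ^ 2 - 4 * r) * S k) :
    mk S = 1 + C c * X * mk S + C r * X ^ 2 * mk S ^ 2 := by
  have ho := ode_aux S c (c ^ 2 - 4 * r) h0 h1 hr
  set s := mk S with hs
  set s' := d⁄dX ℝ s with hs'
  simp only [map_mul, map_sub, map_pow, map_ofNat] at ho
  set D : ℝ⟦X⟧ := 1 - 2 * C c * X + (C c ^ 2 - 4 * C r) * X ^ 2 with hD
  set U : ℝ⟦X⟧ := (1 - C c * X - 2 * C r * X ^ 2 * s) ^ 2 - D with hU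
  have dC : ∀ x : ℝ, d⁄dX ℝ (C x) = 0 := fun x => derivative_C
  have d2 : d⁄dX ℝ (2 : ℝ⟦X⟧) = 0 := by
    have : (2 : ℝ⟦X⟧) = C (2 : ℝ) := (map_ofNat C 2).symm
    rw [this, dC]
  have d4 : d⁄dX ℝ (4 : ℝ⟦X⟧) = 0 := by
    have : (4 : ℝ⟦X⟧) = C (4 : ℝ) := (map_ofNat C 4).symm
    rw [this, dC]
  have hD' : d⁄dX ℝ D = - 2 * C c + 2 * (C c ^ 2 - 4 * C r) * X := by
    simp only [hD, map_add, map_sub, Derivation.leibniz, Derivation.leibniz_pow, dC, d2, d4,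
      derivative_X, Derivation.map_one_eq_zero, smul_eq_mul]
    simp
    ring
  have hU' : d⁄dX ℝ U = 2 * (1 - C c * X - 2 * C r * X ^ 2 * s) *
      (- C c - 4 * C r * X * s - 2 * C r * X ^ 2 * s') - d⁄dX ℝ D := by
    simp only [hU, map_add, map_sub, Derivation.leibniz, Derivation.leibniz_pow, dC, d2, d4,
      derivative_X, Derivation.map_one_eq_zero, smul_eq_mul, ← hs']
    simp
    ring
  have key : D * d⁄dX ℝ U = U * d⁄dX ℝ D := by
    rw [hU', hD', hU, hD]
    linear_combination (-4 * C r * X * (1 - C c * X - 2 * C r * X ^ 2 * s)) * ho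
  have hDc : constantCoeff D ≠ 0 := by simp [hD]
  have hI : D * D⁻¹ = 1 := PowerSeries.mul_inv_cancel D hDc
  have hI' : d⁄dX ℝ D * D⁻¹ + D * d⁄dX ℝ (D⁻¹) = 0 := by
    have := congrArg (d⁄dX ℝ) hI
    rw [Derivation.leibniz, Derivation.map_one_eq_zero] at this
    simp only [smul_eq_mul] at this
    linear_combination this
  have hUI : U * D⁻¹ = 0 := by
    apply PowerSeries.derivative.ext
    · rw [Derivation.leibniz, map_zero]
      simp only [smul_eq_mul]
      linear_combination (D⁻¹ * U) * hI' - (U * d⁄dX ℝ (D⁻¹)  + D⁻¹ * d⁄dX ℝ U) * hI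
        + D⁻¹ * D⁻¹ * key
    · simp [hU, hD]
  have hU0 : U = 0 := by linear_combination D * hUI - U * hI
  have h2 : (4 * C r * X ^ 2) * (s - (1 + C c * X * s + C r * X ^ 2 * s ^ 2)) = 0 := by
    rw [hU, hD] at hU0
    linear_combination -hU0
  have h3 : (4 * C r * X ^ 2 : ℝ⟦X⟧) ≠ 0 := by
    have h4 : (4 * C r : ℝ⟦X⟧) = C (4 * r) := by rw [map_mul, map_ofNat C 4]
    rw [h4]
    refine mul_ne_zero ?_ (pow_ne_zero _ X_ne_zero)
    intro h
    have := congrArg constantCoeff h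
    simp at this
    exact hρ this
  exact sub_eq_zero.1 ((mul_eq_zero.1 h2).resolve_left h3)

lemma rec_M (P Q : ℝ) (s : ℝ⟦X⟧)
    (hs : s = 1 + C (1 + P + Q) * X * s + C (P * (1 + Q)) * X ^ 2 * s ^ 2) :
    (∑ f ∈ NC 1, wt P Q f = Q) ∧
    ∀ k, ∑ f ∈ NC (k + 2), wt P Q f + Q * (P - 1) * ∑ f ∈ NC (k + 1), wt P Q f
      = Q * P * (1 + Q) * coeff k s := by
  set e : ℝ⟦X⟧ := X * s with he
  have hη : e = X * (1 + C P * e) * (1 + (1 + C Q) * e) := by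
    simp only [map_add, map_mul, map_one] at hs
    rw [he]
    linear_combination X * hs
  set N : ℝ⟦X⟧ := 1 - X * C Q * (1 + C P * e) with hN
  set M := N⁻¹ with hMd
  have hNM : N * M = 1 := PowerSeries.mul_inv_cancel N (by simp [hN])
  have hM : M = 1 + X * C Q * M * (1 + C P * e) := by
    rw [hN] at hNM
    linear_combination hNM
  have hE : e = X * M * (1 + C P * e) * (1 + e) := by
    rw [hN] at hNM
    linear_combination (-e) * hNM + M * hη
  have hc := coeff_M P Q M e hM hE
  have h3 : (M - 1) + C (Q * (P - 1)) * (X * (M - 1))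
      = C Q * X + C (Q * P * (1 + Q)) * (X * (X * s)) := by
    simp only [map_add, map_mul, map_sub, map_one]
    rw [hN] at hNM
    rw [← he]
    linear_combination (1 + C Q * (C P - 1) * X) * hM +
      (C Q * X + C Q * C P * (1 + C Q) * X * e) * hNM - C Q ^ 2 * C P * X * M * hη
  constructor
  · have := congrArg (coeff (0 + 1)) h3
    have hM0 : constantCoeff M = 1 := by
      have := congrArg constantCoeff hM
      simpa using this
    rw [← hc]
    simp only [map_add, coeff_C_mul, coeff_succ_X_mul, map_sub, coeff_one, coeff_X,
      coeff_zero_X_mul, coeff_zero_eq_constantCoeff_apply, hM0] at this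
    simpa using this
  · intro k
    have := congrArg (coeff (k + 1 + 1)) h3
    rw [← hc, ← hc]
    simp only [map_add, coeff_C_mul, coeff_succ_X_mul, map_sub, coeff_one, coeff_X] at this
    simpa using this

end FBP

namespace FBP
open MeasureTheory intervalIntegral

/-- Moments of the (unnormalised) semicircle with centre `c` and radius `r`. -/
noncomputable def semi (c r : ℝ) (k : ℕ) : ℝ :=
  ∫ x in (c - r)..(c + r), x ^ k * √(r ^ 2 - (x - c) ^ 2)

lemma semi_zero (c r : ℝ) (hr : 0 < r) : semi c r 0 = π * r ^ 2 / 2 := by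
  have h := intervalIntegral.mul_integral_comp_mul_add (a := -1) (b := 1)
    (f := fun x => √(r ^ 2 - (x - c) ^ 2)) r c
  have h2 : ∀ t : ℝ, √(r ^ 2 - (r * t + c - c) ^ 2) = r * √(1 - t ^ 2) := by
    intro t
    rw [show r ^ 2 - (r * t + c - c) ^ 2 = r ^ 2 * (1 - t ^ 2) by ring,
      Real.sqrt_mul (sq_nonneg r), Real.sqrt_sq hr.le]
  simp only [h2] at h
  rw [intervalIntegral.integral_const_mul, integral_sqrt_one_sub_sq] at h
  unfold semi
  simp only [pow_zero, one_mul]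
  rw [show c - r = r * (-1) + c by ring, show c + r = r * 1 + c by ring, ← h]
  ring

lemma semi_ii (c r : ℝ) (k : ℕ) (a b : ℝ) :
    IntervalIntegrable (fun x => x ^ k * √(r ^ 2 - (x - c) ^ 2)) volume a b := by
  apply Continuous.intervalIntegrable
  fun_prop

lemma semi_deriv (c r : ℝ) (k : ℕ) (x : ℝ) (hx : x ∈ Set.Ioo (c - r) (c + r)) :
    HasDerivAt (fun x => x ^ k * ((r ^ 2 - (x - c) ^ 2) * √(r ^ 2 - (x - c) ^ 2)))
      ((k * x ^ (k - 1)) * ((r ^ 2 - (x - c) ^ 2) * √(r ^ 2 - (x - c) ^ 2))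
        - 3 * x ^ k * ((x - c) * √(r ^ 2 - (x - c) ^ 2))) x := by
  have hpos : 0 < r ^ 2 - (x - c) ^ 2 := by
    obtain ⟨h1, h2⟩ := hx
    nlinarith [mul_pos (sub_pos.2 h1) (sub_pos.2 h2)]
  have hR : HasDerivAt (fun x => r ^ 2 - (x - c) ^ 2) (-(2 * (x - c))) x := by
    have := (((hasDerivAt_id x).sub_const c).pow 2).const_sub (r ^ 2)
    simpa using this
  have hs := hR.sqrt hpos.ne'
  have h := (hasDerivAt_pow k x).mul (hR.mul hs)
  refine h.congr_deriv ?_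
  have hsq : √(r ^ 2 - (x - c) ^ 2) ≠ 0 := (Real.sqrt_pos.2 hpos).ne'
  have hsq2 : √(r ^ 2 - (x - c) ^ 2) ^ 2 = r ^ 2 - (x - c) ^ 2 := Real.sq_sqrt hpos.le
  simp only [Pi.mul_apply]
  set w := √(r ^ 2 - (x - c) ^ 2) with hw
  rw [← hsq2]
  field_simp
  ring

lemma semi_ibp (c r : ℝ) (hr : 0 < r) (k : ℕ) :
    ∫ x in (c - r)..(c + r), ((k * x ^ (k - 1)) * ((r ^ 2 - (x - c) ^ 2) * √(r ^ 2 - (x - c) ^ 2))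
        - 3 * x ^ k * ((x - c) * √(r ^ 2 - (x - c) ^ 2))) = 0 := by
  rw [intervalIntegral.integral_eq_sub_of_hasDerivAt_of_le (by linarith)
    (f := fun x => x ^ k * ((r ^ 2 - (x - c) ^ 2) * √(r ^ 2 - (x - c) ^ 2)))
    (by fun_prop) (fun x hx => semi_deriv c r k x hx)
    (by apply Continuous.intervalIntegrable; fun_prop)]
  simp

lemma semi_one (c r : ℝ) (hr : 0 < r) : semi c r 1 = c * semi c r 0 := by
  have h := semi_ibp c r hr 0
  have h2 : (fun x : ℝ => (((0 : ℕ) : ℝ) * x ^ (0 - 1)) *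
        ((r ^ 2 - (x - c) ^ 2) * √(r ^ 2 - (x - c) ^ 2))
        - 3 * x ^ 0 * ((x - c) * √(r ^ 2 - (x - c) ^ 2)))
      = fun x => (3 * c) * (x ^ 0 * √(r ^ 2 - (x - c) ^ 2))
        - 3 * (x ^ 1 * √(r ^ 2 - (x - c) ^ 2)) := by
    funext x
    simp
    ring
  rw [h2, intervalIntegral.integral_sub ((semi_ii c r 0 _ _).const_mul _)
    ((semi_ii c r 1 _ _).const_mul _), intervalIntegral.integral_const_mul,
    intervalIntegral.integral_const_mul] at h
  unfold semi
  linarith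

lemma semi_rec (c r : ℝ) (hr : 0 < r) (k : ℕ) :
    ((k : ℝ) + 4) * semi c r (k + 2)
      = (2 * k + 5) * c * semi c r (k + 1) - (k + 1) * (c ^ 2 - r ^ 2) * semi c r k := by
  have h := semi_ibp c r hr (k + 1)
  have h2 : (fun x : ℝ => (((k + 1 : ℕ) : ℝ) * x ^ (k + 1 - 1)) *
        ((r ^ 2 - (x - c) ^ 2) * √(r ^ 2 - (x - c) ^ 2))
        - 3 * x ^ (k + 1) * ((x - c) * √(r ^ 2 - (x - c) ^ 2)))
      = fun x => ((2 * k + 5) * c) * (x ^ (k + 1) * √(r ^ 2 - (x - c) ^ 2))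
        - ((k + 1) * (c ^ 2 - r ^ 2)) * (x ^ k * √(r ^ 2 - (x - c) ^ 2))
        - (k + 4) * (x ^ (k + 2) * √(r ^ 2 - (x - c) ^ 2)) := by
    funext x
    simp only [Nat.add_sub_cancel]
    push_cast
    ring
  rw [h2, intervalIntegral.integral_sub (((semi_ii c r _ _ _).const_mul _).sub
    ((semi_ii c r _ _ _).const_mul _)) ((semi_ii c r _ _ _).const_mul _),
    intervalIntegral.integral_sub ((semi_ii c r _ _ _).const_mul _)
    ((semi_ii c r _ _ _).const_mul _), intervalIntegral.integral_const_mul,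
    intervalIntegral.integral_const_mul, intervalIntegral.integral_const_mul] at h
  unfold semi
  linarith

lemma cauchy_unit (u : ℝ) (hu : 1 < u) :
    ∫ t in (-1 : ℝ)..1, √(1 - t ^ 2) / (u + t) = π * (u - √(u ^ 2 - 1)) := by
  have hne : ∀ t ∈ Set.Icc (-1 : ℝ) 1, u + t ≠ 0 := by
    intro t ht
    have := ht.1
    linarith
  have hu2 : 0 < u ^ 2 - 1 := by nlinarith
  rw [intervalIntegral.integral_eq_sub_of_hasDerivAt_of_le (by norm_num)
    (f := fun t => u * Real.arcsin t + √(1 - t ^ 2)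
      - √(u ^ 2 - 1) * Real.arcsin ((1 + u * t) / (u + t)))]
  · have e1 : (1 + u * 1) / (u + 1) = 1 := by
      rw [div_eq_one_iff_eq (by linarith)]; ring
    have e2 : (1 + u * (-1)) / (u + -1) = -1 := by
      rw [div_eq_iff (by linarith)]; ring
    simp only [e1, e2, Real.arcsin_one, Real.arcsin_neg_one]
    norm_num
    ring
  · refine ContinuousOn.sub (by fun_prop) (ContinuousOn.mul (by fun_prop) ?_)
    refine Real.continuous_arcsin.comp_continuousOn ?_
    exact ContinuousOn.div (by fun_prop) (by fun_prop) hne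
  · intro t ht
    obtain ⟨h1, h2⟩ := ht
    have hut : 0 < u + t := by linarith
    have hpos : 0 < 1 - t ^ 2 := by nlinarith
    have d1 := (Real.hasDerivAt_arcsin h1.ne' h2.ne).const_mul u
    have d2 : HasDerivAt (fun t : ℝ => √(1 - t ^ 2)) (-(2 * t) / (2 * √(1 - t ^ 2))) t := by
      have : HasDerivAt (fun t : ℝ => 1 - t ^ 2) (-(2 * t)) t := by
        have := (hasDerivAt_pow 2 t).const_sub 1
        simpa using this
      exact this.sqrt hpos.ne'
    have d3 : HasDerivAt (fun t : ℝ => (1 + u * t) / (u + t)) ((u ^ 2 - 1) / (u + t) ^ 2) t := by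
      have := (((hasDerivAt_id t).const_mul u).const_add 1).div ((hasDerivAt_id t).const_add u)
        hut.ne'
      refine this.congr_deriv ?_
      simp
      ring
    have hlt1 : (1 + u * t) / (u + t) < 1 := by
      rw [div_lt_one hut]; nlinarith
    have hlt2 : -1 < (1 + u * t) / (u + t) := by
      rw [lt_div_iff₀ hut]; nlinarith
    have d4 := ((Real.hasDerivAt_arcsin hlt2.ne' hlt1.ne).comp t d3).const_mul (√(u ^ 2 - 1))
    refine ((d1.add d2).sub d4).congr_deriv ?_
    have e : √(1 - ((1 + u * t) / (u + t)) ^ 2) = √(u ^ 2 - 1) * √(1 - t ^ 2) / (u + t) := by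
      rw [← Real.sqrt_mul hu2.le, eq_div_iff hut.ne']
      conv_lhs => enter [2]; rw [← Real.sqrt_sq hut.le]
      rw [← Real.sqrt_mul' _ (sq_nonneg _)]
      congr 1
      field_simp
      ring
    rw [e]
    have w1 : √(1 - t ^ 2) ≠ 0 := (Real.sqrt_pos.2 hpos).ne'
    have w2 : √(u ^ 2 - 1) ≠ 0 := (Real.sqrt_pos.2 hu2).ne'
    have w3 : √(1 - t ^ 2) ^ 2 = 1 - t ^ 2 := Real.sq_sqrt hpos.le
    field_simp
    rw [w3]
    ring
  · apply ContinuousOn.intervalIntegrable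
    rw [Set.uIcc_of_le (by norm_num)]
    exact ContinuousOn.div (by fun_prop) (by fun_prop) hne

lemma cauchy (c r : ℝ) (hr : 0 < r) (h : r < 1 + c) :
    ∫ x in (c - r)..(c + r), √(r ^ 2 - (x - c) ^ 2) / (1 + x)
      = π * ((1 + c) - √((1 + c) ^ 2 - r ^ 2)) := by
  have h1 := intervalIntegral.mul_integral_comp_mul_add (a := -1) (b := 1)
    (f := fun x => √(r ^ 2 - (x - c) ^ 2) / (1 + x)) r c
  have h2 : ∀ t : ℝ, √(r ^ 2 - (r * t + c - c) ^ 2) / (1 + (r * t + c))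
      = √(1 - t ^ 2) / ((1 + c) / r + t) := by
    intro t
    rw [show r ^ 2 - (r * t + c - c) ^ 2 = r ^ 2 * (1 - t ^ 2) by ring,
      Real.sqrt_mul (sq_nonneg r), Real.sqrt_sq hr.le,
      show 1 + (r * t + c) = r * ((1 + c) / r + t) by field_simp; ring,
      mul_div_mul_left _ _ hr.ne']
  simp only [h2] at h1
  rw [cauchy_unit _ ((one_lt_div hr).2 h)] at h1
  rw [show c - r = r * (-1) + c by ring, show c + r = r * 1 + c by ring, ← h1]
  have h3 : √(((1 + c) / r) ^ 2 - 1) = √((1 + c) ^ 2 - r ^ 2) / r := by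
    rw [show ((1 + c) / r) ^ 2 - 1 = ((1 + c) ^ 2 - r ^ 2) / r ^ 2 by field_simp,
      Real.sqrt_div' _ (sq_nonneg r), Real.sqrt_sq hr.le]
  rw [h3]
  field_simp

end FBP

namespace FBP
open MeasureTheory intervalIntegral

noncomputable def cc (a b : ℝ) : ℝ := (a * b + (a + b - 1)) / (b - 1) ^ 2

noncomputable def rr (a b : ℝ) : ℝ := 2 * (√(a * b) * √(a + b - 1)) / (b - 1) ^ 2

lemma gammaP_eq (a b : ℝ) (ha : 0 < a) (hb : 1 < b) : gammaP a b = cc a b + rr a b := by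
  have h1 : √(a * b) ^ 2 = a * b := Real.sq_sqrt (by positivity)
  have h2 : √(a + b - 1) ^ 2 = a + b - 1 := Real.sq_sqrt (by linarith)
  unfold gammaP cc rr
  rw [div_pow, ← add_div]
  congr 1
  linear_combination h1 + h2

lemma gammaM_eq (a b : ℝ) (ha : 0 < a) (hb : 1 < b) : gammaM a b = cc a b - rr a b := by
  have h1 : √(a * b) ^ 2 = a * b := Real.sq_sqrt (by positivity)
  have h2 : √(a + b - 1) ^ 2 = a + b - 1 := Real.sq_sqrt (by linarith)
  unfold gammaM cc rr
  rw [div_pow, ← sub_div]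
  congr 1
  linear_combination h1 + h2

lemma rr_pos (a b : ℝ) (ha : 0 < a) (hb : 1 < b) : 0 < rr a b := by
  have h1 : 0 < √(a * b) := Real.sqrt_pos.2 (by positivity)
  have h2 : 0 < √(a + b - 1) := Real.sqrt_pos.2 (by linarith)
  have h3 : 0 < b - 1 := by linarith
  unfold rr
  positivity

lemma rr_sq (a b : ℝ) (ha : 0 < a) (hb : 1 < b) :
    rr a b ^ 2 = 4 * (a * b * (a + b - 1)) / (b - 1) ^ 4 := by
  have h1 : √(a * b) ^ 2 = a * b := Real.sq_sqrt (by positivity)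
  have h2 : √(a + b - 1) ^ 2 = a + b - 1 := Real.sq_sqrt (by linarith)
  unfold rr
  rw [div_pow, mul_pow, mul_pow, h1, h2]
  ring

lemma gammaM_nonneg (a b : ℝ) : 0 ≤ gammaM a b := sq_nonneg _

/-- integrand. -/
noncomputable def gg (a b : ℝ) (k : ℕ) (x : ℝ) : ℝ :=
  (b - 1) / (2 * π) * (x ^ k * (√(rr a b ^ 2 - (x - cc a b) ^ 2) / (1 + x)))

lemma gg_cont (a b : ℝ) (ha : 0 < a) (hb : 1 < b) (k : ℕ) :
    ContinuousOn (gg a b k) (Set.Icc (cc a b - rr a b) (cc a b + rr a b)) := by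
  unfold gg
  refine ContinuousOn.mul (by fun_prop) (ContinuousOn.mul (by fun_prop) ?_)
  refine ContinuousOn.div (by fun_prop) (by fun_prop) ?_
  intro x hx
  have := gammaM_nonneg a b
  rw [gammaM_eq a b ha hb] at this
  have := hx.1
  linarith

lemma moment_eq (a b : ℝ) (ha : 0 < a) (hb : 1 < b) (k : ℕ) :
    ∫ x, x ^ (k + 1) ∂(fbp a b)
      = ∫ x in (cc a b - rr a b)..(cc a b + rr a b), gg a b k x := by
  have hP := gammaP_eq a b ha hb
  have hM := gammaM_eq a b ha hb
  have hM0 := gammaM_nonneg a b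
  have hr := rr_pos a b ha hb
  have hmeas : Measurable (fbpDensity a b) := by
    unfold fbpDensity
    refine Measurable.indicator ?_ measurableSet_Icc
    fun_prop
  have hmeas' : Measurable (fun x => ENNReal.ofReal (fbpDensity a b x)) := hmeas.ennreal_ofReal
  have hfin : ∀ᵐ x : ℝ, ENNReal.ofReal (fbpDensity a b x) < ⊤ :=
    Filter.Eventually.of_forall fun x => ENNReal.ofReal_lt_top
  have hnn : ∀ x, 0 ≤ fbpDensity a b x := by
    intro x
    unfold fbpDensity
    refine Set.indicator_nonneg (fun x hx => ?_) x
    have hx0 : 0 ≤ x := hM0.trans hx.1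
    have hb' : 0 ≤ b - 1 := by linarith
    have := Real.pi_pos
    positivity
  have hfun : (fun x => (ENNReal.ofReal (fbpDensity a b x)).toReal • x ^ (k + 1))
      = Set.indicator (Set.Icc (cc a b - rr a b) (cc a b + rr a b)) (gg a b k) := by
    funext x
    rw [ENNReal.toReal_ofReal (hnn x), smul_eq_mul]
    unfold fbpDensity
    rw [hP, hM]
    by_cases hx : x ∈ Set.Icc (cc a b - rr a b) (cc a b + rr a b)
    · rw [Set.indicator_of_mem hx, Set.indicator_of_mem hx]
      unfold gg
      rw [show -((x - (cc a b + rr a b)) * (x - (cc a b - rr a b)))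
        = rr a b ^ 2 - (x - cc a b) ^ 2 by ring]
      have hx0 : 0 ≤ x := by
        have := hx.1
        linarith
      rcases hx0.eq_or_lt with h | h
      · subst h
        have h1 : cc a b - rr a b = 0 := le_antisymm hx.1 (by linarith)
        have h2 : rr a b ^ 2 - (0 - cc a b) ^ 2 = 0 := by
          rw [show cc a b = rr a b by linarith]; ring
        rw [h2]
        simp
      · have h1 : 1 + x ≠ 0 := by linarith
        have := Real.pi_pos
        field_simp
        ring
    · rw [Set.indicator_of_notMem hx, Set.indicator_of_notMem hx]
      simp
  have hgint : IntegrableOn (gg a b k) (Set.Icc (cc a b - rr a b) (cc a b + rr a b)) :=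
    (gg_cont a b ha hb k).integrableOn_Icc
  unfold fbp
  rw [integral_add_measure]
  · rw [integral_withDensity_eq_integral_toReal_smul hmeas' hfin, hfun,
      MeasureTheory.integral_indicator measurableSet_Icc, integral_Icc_eq_integral_Ioc,
      intervalIntegral.integral_of_le (by linarith), MeasureTheory.integral_smul_measure,
      integral_dirac]
    simp
  · rw [integrable_withDensity_iff_integrable_smul' hmeas' hfin, hfun,
      integrable_indicator_iff measurableSet_Icc]
    exact hgint
  · refine Integrable.smul_measure ?_ ENNReal.ofReal_ne_top
    exact integrable_dirac (by simp)

lemma gg_add (a b : ℝ) (ha : 0 < a) (hb : 1 < b) (k : ℕ) :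
    (∫ x in (cc a b - rr a b)..(cc a b + rr a b), gg a b (k + 1) x)
      + ∫ x in (cc a b - rr a b)..(cc a b + rr a b), gg a b k x
      = (b - 1) / (2 * π) * semi (cc a b) (rr a b) k := by
  have hr := rr_pos a b ha hb
  have hle : cc a b - rr a b ≤ cc a b + rr a b := by linarith
  have hii : ∀ k, IntervalIntegrable (gg a b k) volume (cc a b - rr a b) (cc a b + rr a b) := by
    intro k
    apply ContinuousOn.intervalIntegrable
    rw [Set.uIcc_of_le hle]
    exact gg_cont a b ha hb k
  rw [← intervalIntegral.integral_add (hii _) (hii _)]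
  unfold semi
  rw [← intervalIntegral.integral_const_mul]
  refine intervalIntegral.integral_congr fun x hx => ?_
  rw [Set.uIcc_of_le hle] at hx
  have h0 := gammaM_nonneg a b
  rw [gammaM_eq a b ha hb] at h0
  have h1 : 1 + x ≠ 0 := by
    have := hx.1
    linarith
  simp only [gg]
  have := Real.pi_pos
  field_simp
  ring

lemma gg_zero (a b : ℝ) (ha : 0 < a) (hb : 1 < b) :
    ∫ x in (cc a b - rr a b)..(cc a b + rr a b), gg a b 0 x = a / (b - 1) := by
  have h0 := gammaM_nonneg a b
  rw [gammaM_eq a b ha hb] at h0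
  have hb' : 0 < b - 1 := by linarith
  unfold gg
  simp only [pow_zero, one_mul]
  rw [intervalIntegral.integral_const_mul, cauchy _ _ (rr_pos a b ha hb) (by linarith)]
  have h1 : (1 + cc a b) ^ 2 - rr a b ^ 2 = ((a + b) / (b - 1)) ^ 2 := by
    rw [rr_sq a b ha hb]
    unfold cc
    field_simp
    ring
  rw [h1, Real.sqrt_sq (by positivity)]
  unfold cc
  have := Real.pi_pos
  field_simp
  ring

end FBP

theorem fbp_moment_formula (a b : ℝ) (ha : 0 < a) (hb : 1 < b) (n : ℕ) (hn : 1 ≤ n) :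
    ∫ x, x ^ n ∂(fbp a b)
      = (a / (b - 1) ^ 2) ^ n *
          ∑ p ∈ NCL n, ((a + b - 1) / a) ^ (dc p + sc p) * (b - 1) ^ (sc p + sg p) := by
  have hb' : 0 < b - 1 := by linarith
  have hab : 0 < a + b - 1 := by linarith
  have hpi := Real.pi_pos
  have hr := FBP.rr_pos a b ha hb
  have hr2 := FBP.rr_sq a b ha hb
  rw [FBP.sum_NCL]
  obtain ⟨k, rfl⟩ : ∃ k, n = k + 1 := ⟨n - 1, by omega⟩
  rw [FBP.moment_eq a b ha hb]
  set κ : ℝ := a / (b - 1) ^ 2 with hκ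
  set P : ℝ := (a + b - 1) / a with hP
  set Q : ℝ := b - 1 with hQ
  have hκ0 : 0 < κ := by positivity
  set c := FBP.cc a b with hc
  set r := FBP.rr a b with hrdef
  have hcκ : c = κ * (1 + P + Q) := by
    rw [hc, FBP.cc, hκ, hP, hQ]
    field_simp
    ring
  have hrκ : r ^ 2 = 4 * (κ ^ 2 * (P * (1 + Q))) := by
    rw [hr2, hκ, hP, hQ]
    field_simp
    ring
  have hκQ : κ * (Q * (P - 1)) = 1 := by
    have hQb : a + b - 1 = a + Q := by rw [hQ]; ring
    rw [hκ, hP, hQb]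
    field_simp
    ring
  have hρ : P * (1 + Q) ≠ 0 := by
    have : 0 < P * (1 + Q) := by positivity
    exact this.ne'
  set S : ℕ → ℝ := fun k => 2 / (π * r ^ 2) * (FBP.semi c r k / κ ^ k) with hS
  have hsS : ∀ k, FBP.semi c r k = π * r ^ 2 / 2 * (κ ^ k * S k) := by
    intro k
    simp only [hS]
    field_simp
  have hA : π * r ^ 2 / 2 ≠ 0 := by positivity
  have hS0 : S 0 = 1 := by
    have h := FBP.semi_zero c r hr
    rw [hsS] at h
    apply mul_left_cancel₀ hA
    linear_combination h
  have hS1 : S 1 = 1 + P + Q := by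
    have h := FBP.semi_one c r hr
    rw [hsS, hsS, hS0, hcκ] at h
    apply mul_left_cancel₀ (mul_ne_zero hA hκ0.ne')
    linear_combination h
  have hSr : ∀ k : ℕ, ((k : ℝ) + 4) * S (k + 2) = (2 * k + 5) * (1 + P + Q) * S (k + 1)
      - (k + 1) * ((1 + P + Q) ^ 2 - 4 * (P * (1 + Q))) * S k := by
    intro k
    have h := FBP.semi_rec c r hr k
    rw [hsS, hsS, hsS] at h
    apply mul_left_cancel₀ (mul_ne_zero hA (pow_ne_zero (k + 2) hκ0.ne'))
    have h2 : c ^ 2 - r ^ 2 = κ ^ 2 * ((1 + P + Q) ^ 2 - 4 * (P * (1 + Q))) := by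
      rw [hrκ, hcκ]; ring
    rw [h2, hcκ] at h
    linear_combination h
  have hq := FBP.quad_aux S (1 + P + Q) (P * (1 + Q)) hρ hS0 hS1 hSr
  obtain ⟨m1, mk⟩ := FBP.rec_M P Q _ hq
  simp only [PowerSeries.coeff_mk] at mk
  induction k with
  | zero =>
    rw [FBP.gg_zero a b ha hb, zero_add, m1, hκ, hQ]
    field_simp
  | succ k ih =>
    have h1 := FBP.gg_add a b ha hb k
    rw [ih (by omega)] at h1
    have h2 := mk k
    have h3 : (b - 1) / (2 * π) * FBP.semi c r k = κ ^ (k + 2) * (Q * P * (1 + Q) * S k) := by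
      rw [hsS, hrκ, ← hQ]
      field_simp
      ring
    rw [h3, ← h2] at h1
    linear_combination h1 + κ ^ (k + 1) * (∑ f ∈ FBP.NC (k + 1), FBP.wt P Q f) * hκQ
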